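/- arXiv:1601.00390 — 2 statements merged into one kernel-verified Lean document; each statement's English description precedes it below -/
import Mathlib

section
/- Let B be a symmetric bilinear form on ℝ^{m×n} and set f(A) := B(A,A) for A ∈ ℝ^{m×n}. Then the following are equivalent: (i) f(a bᵀ) ≥ 0 for all a ∈ ℝ^m and b ∈ ℝⁿ (rank-one convexity of the quadratic form f); (ii) ∫_{ℝⁿ} f(∇φ(x)) dx ≥ 0 for every smooth compactly supported map φ : ℝⁿ → ℝ^m (quasiconvexity of f). (Van Hove's theorem: for quadratic forms, rank-one convexity and quasiconvexity coincide.) -/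
open MeasureTheory Filter Topology Metric Bornology
open scoped ENNReal NNReal

noncomputable section

/-- The gradient of a map `φ : ℝⁿ → ℝᵐ`, identified with an `m × n` matrix. -/
def grad {n m : ℕ} (u : EuclideanSpace ℝ (Fin n) → EuclideanSpace ℝ (Fin m))
    (x : EuclideanSpace ℝ (Fin n)) : Matrix (Fin m) (Fin n) ℝ :=
  Matrix.of fun i j => fderiv ℝ u x (EuclideanSpace.single j 1) i

open scoped FourierTransform LineDeriv SchwartzMap

/-- Coordinate expansion of a bilinear form on matrices. -/
lemma vh_expand {m n : ℕ}
    (B : Matrix (Fin m) (Fin n) ℝ →ₗ[ℝ] Matrix (Fin m) (Fin n) ℝ →ₗ[ℝ] ℝ)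
    (A : Matrix (Fin m) (Fin n) ℝ) :
    B A A = ∑ p : Fin m × Fin n, ∑ q : Fin m × Fin n,
      (A p.1 p.2 * A q.1 q.2) * B (Matrix.single p.1 p.2 1) (Matrix.single q.1 q.2 1) := by
  have hA : A = ∑ p : Fin m × Fin n, A p.1 p.2 • Matrix.single p.1 p.2 (1 : ℝ) := by
    conv_lhs => rw [Matrix.matrix_eq_sum_single A]
    rw [Fintype.sum_prod_type]
    simp [Matrix.smul_single]
  conv_lhs => rw [hA]
  simp only [map_sum, map_smul, LinearMap.sum_apply, LinearMap.smul_apply, smul_eq_mul,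
    Finset.mul_sum]
  rw [Finset.sum_comm]
  refine Finset.sum_congr rfl fun p _ => Finset.sum_congr rfl fun q _ => ?_
  ring

lemma vh_grad_continuous {m n : ℕ} {φ : EuclideanSpace ℝ (Fin n) → EuclideanSpace ℝ (Fin m)}
    (h : ContDiff ℝ (⊤ : ℕ∞) φ) (i : Fin m) (j : Fin n) :
    Continuous fun x => grad φ x i j := by
  have h1 : Continuous (fderiv ℝ φ) := h.continuous_fderiv (by simp)
  have h2 : Continuous fun x => fderiv ℝ φ x (EuclideanSpace.single j 1) := by fun_prop
  simp only [grad, Matrix.of_apply]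
  fun_prop

lemma vh_grad_compact {m n : ℕ} {φ : EuclideanSpace ℝ (Fin n) → EuclideanSpace ℝ (Fin m)}
    (h : HasCompactSupport φ) (i : Fin m) (j : Fin n) :
    HasCompactSupport fun x => grad φ x i j := by
  have := h.fderiv_apply ℝ (EuclideanSpace.single j (1 : ℝ))
  exact this.comp_left (g := fun v : EuclideanSpace ℝ (Fin m) => v i) rfl

lemma vh_integrable_mul {m n : ℕ} {φ : EuclideanSpace ℝ (Fin n) → EuclideanSpace ℝ (Fin m)}
    (h : ContDiff ℝ (⊤ : ℕ∞) φ) (hc : HasCompactSupport φ) (p q : Fin m × Fin n) :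
    Integrable fun x => grad φ x p.1 p.2 * grad φ x q.1 q.2 :=
  ((vh_grad_continuous h _ _).mul (vh_grad_continuous h _ _)).integrable_of_hasCompactSupport
    ((vh_grad_compact hc _ _).mul_right)

lemma vh_integrable {m n : ℕ} {φ : EuclideanSpace ℝ (Fin n) → EuclideanSpace ℝ (Fin m)}
    (B : Matrix (Fin m) (Fin n) ℝ →ₗ[ℝ] Matrix (Fin m) (Fin n) ℝ →ₗ[ℝ] ℝ)
    (h : ContDiff ℝ (⊤ : ℕ∞) φ) (hc : HasCompactSupport φ) :
    Integrable fun x => B (grad φ x) (grad φ x) := by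
  simp_rw [vh_expand B]
  exact integrable_finsetSum _ fun p _ => integrable_finsetSum _ fun q _ =>
    (vh_integrable_mul h hc p q).mul_const _

lemma vh_inner_integrable {n : ℕ} (f g : 𝓢(EuclideanSpace ℝ (Fin n), ℂ)) :
    Integrable fun x => inner ℂ (f x) (g x) := by
  have hf : MemLp (fun x => f x) 2 volume := f.memLp 2
  have hg : MemLp (fun x => g x) 2 volume := g.memLp 2
  have := MemLp.integrable_mul hg hf.star
  simpa [RCLike.inner_apply] using! this

lemma vh_forward {m n : ℕ}
    (B : Matrix (Fin m) (Fin n) ℝ →ₗ[ℝ] Matrix (Fin m) (Fin n) ℝ →ₗ[ℝ] ℝ)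
    (hB : ∀ (a : Fin m → ℝ) (b : Fin n → ℝ),
        0 ≤ B (Matrix.vecMulVec a b) (Matrix.vecMulVec a b))
    (φ : EuclideanSpace ℝ (Fin n) → EuclideanSpace ℝ (Fin m))
    (h : ContDiff ℝ (⊤ : ℕ∞) φ) (hc : HasCompactSupport φ) :
    0 ≤ ∫ x, B (grad φ x) (grad φ x) := by
  have hsm : ∀ i, ContDiff ℝ (⊤ : ℕ∞) (fun x => ((φ x i : ℝ) : ℂ)) := fun i =>
    Complex.ofRealCLM.contDiff.comp ((EuclideanSpace.proj (𝕜 := ℝ) i).contDiff.comp h)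
  have hcs : ∀ i, HasCompactSupport (fun x => ((φ x i : ℝ) : ℂ)) := fun i =>
    hc.comp_left (g := fun v : EuclideanSpace ℝ (Fin m) => ((v i : ℝ) : ℂ)) (by simp)
  let ψ : Fin m → 𝓢(EuclideanSpace ℝ (Fin n), ℂ) := fun i => (hcs i).toSchwartzMap (hsm i)
  let D : Fin m × Fin n → 𝓢(EuclideanSpace ℝ (Fin n), ℂ) :=
    fun p => ∂_{EuclideanSpace.single p.2 (1 : ℝ)} (ψ p.1)
  have hD : ∀ p x, D p x = ((grad φ x p.1 p.2 : ℝ) : ℂ) := by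
    intro p x
    have hd : DifferentiableAt ℝ φ x := (h.differentiable (by simp)) x
    have h1 : HasFDerivAt (fun x => ((φ x p.1 : ℝ) : ℂ))
        ((Complex.ofRealCLM.comp (EuclideanSpace.proj (𝕜 := ℝ) p.1)).comp (fderiv ℝ φ x)) x :=
      (Complex.ofRealCLM.comp (EuclideanSpace.proj (𝕜 := ℝ) p.1)).hasFDerivAt.comp x
        hd.hasFDerivAt
    have h2 : D p x = fderiv ℝ (fun x => ((φ x p.1 : ℝ) : ℂ)) x (EuclideanSpace.single p.2 1) :=
      SchwartzMap.lineDerivOp_apply_eq_fderiv _ _ _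
    rw [h2, h1.fderiv]
    simp [grad]
  have hFD : ∀ p ξ, 𝓕 (D p) ξ = (2 * Real.pi * Complex.I) * ((ξ p.2 : ℝ) * 𝓕 (ψ p.1) ξ) := by
    intro p ξ
    have ht : (inner ℝ · (EuclideanSpace.single p.2 (1 : ℝ)) :
        EuclideanSpace ℝ (Fin n) → ℝ).HasTemperateGrowth :=
      ((innerSL ℝ).flip _).hasTemperateGrowth
    simp only [D]
    rw [SchwartzMap.fourier_lineDerivOp_eq]
    rw [smul_apply, SchwartzMap.smulLeftCLM_apply_apply ht]
    simp [EuclideanSpace.inner_single_right]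
  have key : ∀ p q, ∫ x, grad φ x p.1 p.2 * grad φ x q.1 q.2
      = ∫ ξ, ((𝓕 (D p) ξ).re * (𝓕 (D q) ξ).re + (𝓕 (D p) ξ).im * (𝓕 (D q) ξ).im) := by
    intro p q
    have h1 := SchwartzMap.integral_inner_fourier_fourier (D p) (D q)
    have h2 := congrArg RCLike.re h1
    rw [← integral_re (vh_inner_integrable _ _), ← integral_re (vh_inner_integrable _ _)] at h2
    simp only [hD] at h2
    convert h2.symm using 1
    · congr 1; ext x; simp [mul_comm]
    · congr 1; ext x; simp; ring
  have keyI : ∀ p q, Integrable fun ξ =>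
      ((𝓕 (D p) ξ).re * (𝓕 (D q) ξ).re + (𝓕 (D p) ξ).im * (𝓕 (D q) ξ).im) := by
    intro p q
    refine (vh_inner_integrable (𝓕 (D p)) (𝓕 (D q))).re.congr (ae_of_all _ fun x => ?_)
    simp
    ring
  have e : ∫ x, B (grad φ x) (grad φ x) = ∫ ξ,
      (B (Matrix.of fun i j => (𝓕 (D (i, j)) ξ).re) (Matrix.of fun i j => (𝓕 (D (i, j)) ξ).re)
      + B (Matrix.of fun i j => (𝓕 (D (i, j)) ξ).im)
        (Matrix.of fun i j => (𝓕 (D (i, j)) ξ).im)) := by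
    simp_rw [vh_expand B]
    rw [integral_finsetSum _ fun p _ => integrable_finsetSum _ fun q _ =>
      (vh_integrable_mul h hc p q).mul_const _]
    simp_rw [← Finset.sum_add_distrib, ← add_mul, Matrix.of_apply, Prod.mk.eta]
    rw [integral_finsetSum _ fun p _ => integrable_finsetSum _ fun q _ =>
      (keyI p q).mul_const _]
    refine Finset.sum_congr rfl fun p _ => ?_
    rw [integral_finsetSum _ fun q _ => (vh_integrable_mul h hc p q).mul_const _,
      integral_finsetSum _ fun q _ => (keyI p q).mul_const _]
    refine Finset.sum_congr rfl fun q _ => ?_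
    rw [integral_mul_const, integral_mul_const, key]
  rw [e]
  refine integral_nonneg fun ξ => ?_
  have hre : (Matrix.of fun i j => (𝓕 (D (i, j)) ξ).re) =
      Matrix.vecMulVec (fun i => -(2 * Real.pi) * (𝓕 (ψ i) ξ).im) (fun j => ξ j) := by
    ext i j
    simp [hFD, Matrix.vecMulVec_apply]
    ring
  have him : (Matrix.of fun i j => (𝓕 (D (i, j)) ξ).im) =
      Matrix.vecMulVec (fun i => (2 * Real.pi) * (𝓕 (ψ i) ξ).re) (fun j => ξ j) := by
    ext i j
    simp [hFD, Matrix.vecMulVec_apply]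
    ring
  simp only [Pi.zero_apply]
  rw [hre, him]
  exact add_nonneg (hB _ _) (hB _ _)

lemma vh_grad_smul {m n : ℕ} (g : EuclideanSpace ℝ (Fin n) → ℝ) (a : EuclideanSpace ℝ (Fin m))
    (x : EuclideanSpace ℝ (Fin n)) (g' : EuclideanSpace ℝ (Fin n) →L[ℝ] ℝ)
    (hg : HasFDerivAt g g' x) :
    grad (fun y => g y • a) x =
      Matrix.vecMulVec (fun i => a i) (fun j => g' (EuclideanSpace.single j 1)) := by
  ext i j
  simp [grad, (hg.smul_const a).fderiv, Matrix.vecMulVec_apply, mul_comm]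

lemma vh_backward {m n : ℕ}
    (B : Matrix (Fin m) (Fin n) ℝ →ₗ[ℝ] Matrix (Fin m) (Fin n) ℝ →ₗ[ℝ] ℝ)
    (hsymm : ∀ A₁ A₂, B A₁ A₂ = B A₂ A₁)
    (hB : ∀ φ : EuclideanSpace ℝ (Fin n) → EuclideanSpace ℝ (Fin m),
        ContDiff ℝ (⊤ : ℕ∞) φ → HasCompactSupport φ → 0 ≤ ∫ x, B (grad φ x) (grad φ x))
    (a : Fin m → ℝ) (b : Fin n → ℝ) :
    0 ≤ B (Matrix.vecMulVec a b) (Matrix.vecMulVec a b) := by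
  let a' : EuclideanSpace ℝ (Fin m) := WithLp.toLp 2 a
  let b' : EuclideanSpace ℝ (Fin n) := WithLp.toLp 2 b
  let η : ContDiffBump (0 : EuclideanSpace ℝ (Fin n)) := ⟨1, 2, one_pos, one_lt_two⟩
  have hη : ContDiff ℝ (⊤ : ℕ∞) η := η.contDiff
  have hηc : HasCompactSupport η := η.hasCompactSupport
  let L : EuclideanSpace ℝ (Fin n) →L[ℝ] ℝ := innerSL ℝ b'
  have hLs : ∀ j, L (EuclideanSpace.single j 1) = b j := by
    intro j
    simp [L, b', EuclideanSpace.inner_single_right]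
  have sm : ∀ g : EuclideanSpace ℝ (Fin n) → ℝ, ContDiff ℝ (⊤ : ℕ∞) g →
      ContDiff ℝ (⊤ : ℕ∞) (fun x => (η x * g x) • a') := fun g hg =>
    (hη.mul hg).smul contDiff_const
  have cs : ∀ g : EuclideanSpace ℝ (Fin n) → ℝ,
      HasCompactSupport (fun x => (η x * g x) • a') := fun g =>
    (hηc.mul_right (f' := g)).smul_right (f' := fun _ => a')
  set I := ∫ x, B (grad (fun y => (η y * 1) • a') x) (grad (fun y => (η y * 1) • a') x) with hI
  have hIi := vh_integrable B (sm (fun _ => 1) contDiff_const) (cs (fun _ => 1))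
  have hsq : HasCompactSupport fun x => (η x) ^ 2 :=
    hηc.comp_left (g := fun s : ℝ => s ^ 2) (by simp)
  have hJi : Integrable fun x => (η x) ^ 2 :=
    (η.continuous.pow 2).integrable_of_hasCompactSupport hsq
  have hJ : 0 < ∫ x, (η x) ^ 2 := by
    refine (η.continuous.pow 2).integral_pos_of_hasCompactSupport_nonneg_nonzero
      (x := 0) hsq (fun x => sq_nonneg _) ?_
    have : η 0 = 1 := η.one_of_mem_closedBall (by simp [η])
    simp [this]
  have main : ∀ t : ℝ, 0 ≤ I + (∫ x, (η x) ^ 2) *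
      (t ^ 2 * B (Matrix.vecMulVec a b) (Matrix.vecMulVec a b)) := by
    intro t
    have sc : ContDiff ℝ (⊤ : ℕ∞) (fun x => Real.cos (t * L x)) :=
      Real.contDiff_cos.comp (contDiff_const.mul L.contDiff)
    have ss : ContDiff ℝ (⊤ : ℕ∞) (fun x => Real.sin (t * L x)) :=
      Real.contDiff_sin.comp (contDiff_const.mul L.contDiff)
    have h1 := hB _ (sm _ sc) (cs _)
    have h2 := hB _ (sm _ ss) (cs _)
    have h3 := add_nonneg h1 h2
    rw [← integral_add (vh_integrable B (sm _ sc) (cs _)) (vh_integrable B (sm _ ss) (cs _))] at h3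
    rw [hI, ← integral_mul_const, ← integral_add hIi (hJi.mul_const _)]
    refine h3.trans_eq (integral_congr_ae (ae_of_all _ fun x => ?_))
    have dη : HasFDerivAt η (fderiv ℝ η x) x := (hη.differentiable (by simp) x).hasFDerivAt
    have dL : HasFDerivAt (fun y => t * L y) (t • L) x := L.hasFDerivAt.const_mul t
    have e1 := vh_grad_smul _ a' x _ (dη.mul dL.cos)
    have e2 := vh_grad_smul _ a' x _ (dη.mul dL.sin)
    have e0 := vh_grad_smul _ a' x _ (dη.mul (hasFDerivAt_const (1 : ℝ) x))
    set V := Matrix.vecMulVec a (fun j => fderiv ℝ η x (EuclideanSpace.single j 1)) with hV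
    set W := Matrix.vecMulVec a b with hW
    have f0 : grad (fun y => (η y * 1) • a') x = V := by
      refine e0.trans ?_
      ext i j
      simp [hV, Matrix.vecMulVec_apply, a']
    have f1 : grad (fun y => (η y * Real.cos (t * L y)) • a') x =
        Real.cos (t * L x) • V - (t * η x * Real.sin (t * L x)) • W := by
      refine e1.trans ?_
      ext i j
      simp [hV, hW, Matrix.vecMulVec_apply, a', hLs]
      ring
    have f2 : grad (fun y => (η y * Real.sin (t * L y)) • a') x =
        Real.sin (t * L x) • V + (t * η x * Real.cos (t * L x)) • W := by
      refine e2.trans ?_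
      ext i j
      simp [hV, hW, Matrix.vecMulVec_apply, a', hLs]
      ring
    simp only [f0, f1, f2]
    simp only [map_add, map_sub, map_smul, LinearMap.add_apply, LinearMap.sub_apply,
      LinearMap.smul_apply, smul_eq_mul, hsymm W V]
    have hsc := Real.sin_sq_add_cos_sq (t * L x)
    linear_combination (B V V + (t * η x) ^ 2 * B W W) * hsc
  by_contra hneg
  push Not at hneg
  set q := B (Matrix.vecMulVec a b) (Matrix.vecMulVec a b)
  set J := ∫ x, (η x) ^ 2
  have hJq : J * q < 0 := mul_neg_of_pos_of_neg hJ hneg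
  have hI0 : 0 ≤ I := by simpa using main 0
  have h4 := main (Real.sqrt ((I + 1) / (-(J * q))))
  rw [Real.sq_sqrt (div_nonneg (by linarith) (by linarith))] at h4
  have h5 : J * ((I + 1) / (-(J * q)) * q) = -(I + 1) := by
    have : J * q ≠ 0 := hJq.ne
    have hJ0 : J ≠ 0 := hJ.ne'
    have hq0 : q ≠ 0 := hneg.ne
    field_simp
  linarith

/-- Van Hove's theorem: for the quadratic form `f(A) = B(A,A)` associated with a symmetric
bilinear form `B` on `ℝ^{m×n}`, rank-one convexity (`f(a bᵀ) ≥ 0` for all vectors `a, b`)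
is equivalent to quasiconvexity (`∫ f(∇φ) ≥ 0` for every smooth compactly supported
`φ : ℝⁿ → ℝᵐ`). -/
theorem stmt8 {m n : ℕ}
    (B : Matrix (Fin m) (Fin n) ℝ →ₗ[ℝ] Matrix (Fin m) (Fin n) ℝ →ₗ[ℝ] ℝ)
    (hsymm : ∀ A₁ A₂, B A₁ A₂ = B A₂ A₁) :
    ((∀ (a : Fin m → ℝ) (b : Fin n → ℝ),
        0 ≤ B (Matrix.vecMulVec a b) (Matrix.vecMulVec a b)) ↔
      (∀ φ : EuclideanSpace ℝ (Fin n) → EuclideanSpace ℝ (Fin m),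
        ContDiff ℝ (⊤ : ℕ∞) φ → HasCompactSupport φ →
          0 ≤ ∫ x, B (grad φ x) (grad φ x))) := by
  exact ⟨fun h φ h1 h2 => vh_forward B h φ h1 h2, fun h a b => vh_backward B hsymm h a b⟩
end
end

section
/- (Morrey; sufficiency part of Meyers' theorem for k = 1) Let Ω ⊂ ℝⁿ be a bounded open set with Lipschitz boundary and let f : Ω̄ × ℝ^m × ℝ^{m×n} → ℝ be continuous and such that f(x,s,·) is quasiconvex for every x ∈ Ω̄ and s ∈ ℝ^m. Let {u_j} be a sequence of maps u_j : Ω → ℝ^m that are Lipschitz with a common Lipschitz constant, uniformly bounded, and converging uniformly on Ω to a map u. Then ∫_Ω f(x, u(x), ∇u(x)) dx ≤ liminf_{j→∞} ∫_Ω f(x, u_j(x), ∇u_j(x)) dx. -/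
open MeasureTheory Filter Topology Metric Bornology
open scoped ENNReal NNReal RealInnerProductSpace

noncomputable section

/-- A set `Ω ⊆ ℝⁿ` has Lipschitz boundary if near each boundary point, after a rotation,
`Ω` is the region above the graph of a Lipschitz function. -/
def HasLipschitzBoundary {n : ℕ} (Ω : Set (EuclideanSpace ℝ (Fin n))) : Prop :=
  ∀ x ∈ frontier Ω, ∃ (v : EuclideanSpace ℝ (Fin n)) (r : ℝ) (K : ℝ≥0)
      (h : EuclideanSpace ℝ (Fin n) → ℝ), ‖v‖ = 1 ∧ 0 < r ∧ LipschitzWith K h ∧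
      ∀ z ∈ Metric.ball x r, (z ∈ Ω ↔ h (z - ⟪z, v⟫ • v) < ⟪z, v⟫)

/-- `g : ℝ^{m×n} → ℝ` is quasiconvex: for every bounded open `D ⊆ ℝⁿ`, every matrix `A`
and every Lipschitz map `φ` vanishing outside `D`, `g(A)·|D| ≤ ∫_D g(A + ∇φ)`. -/
def QuasiconvexFn {m n : ℕ} (g : Matrix (Fin m) (Fin n) ℝ → ℝ) : Prop :=
  ∀ D : Set (EuclideanSpace ℝ (Fin n)), IsOpen D → Bornology.IsBounded D →
    ∀ (A : Matrix (Fin m) (Fin n) ℝ) (φ : EuclideanSpace ℝ (Fin n) → EuclideanSpace ℝ (Fin m)),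
      (∃ K : ℝ≥0, LipschitzWith K φ) → (∀ x ∉ D, φ x = 0) →
        g A * (volume D).toReal ≤ ∫ x in D, g (A + grad φ x)

/-- Shorthand for Euclidean space. -/
abbrev EE (n : ℕ) := EuclideanSpace ℝ (Fin n)

lemma clip_abs (a b : ℝ) : |max 0 (min 1 a) - max 0 (min 1 b)| ≤ |a - b| := by
  grind

/-- The cutoff function. -/
def cutoff {n : ℕ} (x0 : EE n) (r θ : ℝ) (x : EE n) : ℝ :=
  max 0 (min 1 ((r - dist x x0) / (θ * r)))

lemma cutoff_nonneg {n : ℕ} (x0 : EE n) (r θ : ℝ) (x : EE n) : 0 ≤ cutoff x0 r θ x :=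
  le_max_left _ _

lemma cutoff_le_one {n : ℕ} (x0 : EE n) (r θ : ℝ) (x : EE n) : cutoff x0 r θ x ≤ 1 :=
  max_le zero_le_one (min_le_left _ _)

lemma cutoff_zero {n : ℕ} (x0 : EE n) {r θ : ℝ} (hr : 0 < r) (hθ : 0 < θ) (x : EE n)
    (hx : x ∉ ball x0 r) : cutoff x0 r θ x = 0 := by
  rw [mem_ball, not_lt] at hx
  apply max_eq_left
  apply (min_le_right _ _).trans
  apply div_nonpos_of_nonpos_of_nonneg (by linarith) (by positivity)

lemma cutoff_one {n : ℕ} (x0 : EE n) {r θ : ℝ} (hr : 0 < r) (hθ : 0 < θ) (x : EE n)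
    (hx : x ∈ ball x0 ((1 - θ) * r)) : cutoff x0 r θ x = 1 := by
  rw [mem_ball] at hx
  have : 1 ≤ (r - dist x x0) / (θ * r) := by
    rw [le_div_iff₀ (by positivity)]; nlinarith
  unfold cutoff
  rw [min_eq_left this]; simp

lemma cutoff_sub {n : ℕ} (x0 : EE n) {r θ : ℝ} (hr : 0 < r) (hθ : 0 < θ) (x y : EE n) :
    |cutoff x0 r θ x - cutoff x0 r θ y| * (θ * r) ≤ dist x y := by
  have h1 := clip_abs ((r - dist x x0) / (θ * r)) ((r - dist y x0) / (θ * r))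
  have h2 : |(r - dist x x0) / (θ * r) - (r - dist y x0) / (θ * r)| * (θ * r)
      = |dist x x0 - dist y x0| := by
    rw [← sub_div, abs_div, abs_of_pos (show 0 < θ * r by positivity),
      div_mul_cancel₀ _ (by positivity)]
    rw [abs_sub_comm]; congr 1; ring
  calc _ ≤ _ := mul_le_mul_of_nonneg_right h1 (by positivity)
    _ = _ := h2
    _ ≤ _ := abs_dist_sub_le _ _ _

lemma cutoff_lip {n m : ℕ} (x0 : EE n) {r θ : ℝ} (hr : 0 < r) (hθ : 0 < θ)
    (v : EE n → EE m) (L : ℝ≥0) (hv : LipschitzWith L v)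
    (hb : ∀ x ∈ ball x0 r, ‖v x‖ ≤ θ * r) :
    LipschitzWith (L + 1) (fun x => cutoff x0 r θ x • v x) := by
  have key : ∀ x y, x ∈ ball x0 r →
      dist (cutoff x0 r θ x • v x) (cutoff x0 r θ y • v y) ≤ (L + 1) * dist x y := by
    intro x y hx
    rw [dist_eq_norm]
    have e : cutoff x0 r θ x • v x - cutoff x0 r θ y • v y
      = (cutoff x0 r θ x - cutoff x0 r θ y) • v x + cutoff x0 r θ y • (v x - v y) := by
      module
    rw [e]
    have h1 : ‖(cutoff x0 r θ x - cutoff x0 r θ y) • v x‖ ≤ dist x y := by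
      rw [norm_smul, Real.norm_eq_abs]
      exact (mul_le_mul_of_nonneg_left (hb x hx) (abs_nonneg _)).trans (cutoff_sub x0 hr hθ x y)
    have h2 : ‖cutoff x0 r θ y • (v x - v y)‖ ≤ L * dist x y := by
      rw [norm_smul, Real.norm_eq_abs, abs_of_nonneg (cutoff_nonneg _ _ _ _)]
      have := hv.dist_le_mul x y
      rw [dist_eq_norm] at this
      calc _ ≤ 1 * ‖v x - v y‖ :=
            mul_le_mul_of_nonneg_right (cutoff_le_one _ _ _ _) (norm_nonneg _)
        _ ≤ _ := by rw [one_mul]; exact this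
    linarith [norm_add_le ((cutoff x0 r θ x - cutoff x0 r θ y) • v x)
      (cutoff x0 r θ y • (v x - v y))]
  apply LipschitzWith.of_dist_le_mul
  intro x y
  push_cast
  by_cases hx : x ∈ ball x0 r
  · exact key x y hx
  · by_cases hy : y ∈ ball x0 r
    · rw [dist_comm, dist_comm x y]; exact key y x hy
    · simp only [cutoff_zero x0 hr hθ x hx, cutoff_zero x0 hr hθ y hy, zero_smul, dist_self]
      positivity

/-- Quasiconvexity on continuous linear maps. -/
def QC {m n : ℕ} (g : (EE n →L[ℝ] EE m) → ℝ) : Prop :=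
  ∀ D : Set (EE n), IsOpen D → Bornology.IsBounded D →
    ∀ (A : EE n →L[ℝ] EE m) (φ : EE n → EE m),
      (∃ K : ℝ≥0, LipschitzWith K φ) → (∀ x ∉ D, φ x = 0) →
        g A * volume.real D ≤ ∫ x in D, g (A + fderiv ℝ φ x)

lemma intOn_of_bound {n : ℕ} {S : Set (EE n)} (hS : MeasurableSet S) (hSb : IsBounded S)
    {h : EE n → ℝ} (hm : AEStronglyMeasurable h (volume.restrict S)) {C : ℝ}
    (hC : ∀ x ∈ S, |h x| ≤ C) : IntegrableOn h S := by
  have : IsFiniteMeasure (volume.restrict S) := ⟨by simpa using hSb.measure_lt_top⟩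
  apply Integrable.of_bound hm C
  exact (ae_restrict_iff' hS).2 (Eventually.of_forall hC)

lemma local_ineq {m n : ℕ} (g : (EE n →L[ℝ] EE m) → ℝ) (hg : Continuous g) (hq : QC g)
    (K : ℝ≥0) {C0 : ℝ} (hC0 : ∀ A : EE n →L[ℝ] EE m, ‖A‖ ≤ 3 * K + 1 → |g A| ≤ C0)
    (x0 : EE n) {r θ : ℝ} (hr : 0 < r) (hθ : 0 < θ) (hθ1 : θ < 1)
    (A : EE n →L[ℝ] EE m) (hA : ‖A‖ ≤ K) (b : EE m)
    (w : EE n → EE m) (hw : LipschitzWith K w)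
    (hwb : ∀ x ∈ ball x0 r, ‖w x - (b + A (x - x0))‖ ≤ θ * r) :
    g A * volume.real (ball x0 r) ≤ (∫ x in ball x0 r, g (fderiv ℝ w x))
      + 2 * C0 * (1 - (1 - θ) ^ n) * volume.real (ball x0 r) := by
  set v : EE n → EE m := fun x => w x - (b + A (x - x0)) with hvdef
  have hAL : LipschitzWith K (fun x => b + A (x - x0)) := by
    apply LipschitzWith.of_dist_le_mul
    intro x y
    rw [dist_add_left, dist_eq_norm, ← map_sub, sub_sub_sub_cancel_right, dist_eq_norm]
    exact A.le_of_opNorm_le hA _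
  have hv : LipschitzWith (K + K) v := hw.sub hAL
  have hφ := cutoff_lip x0 hr hθ v (K + K) hv hwb
  set φ := fun x => cutoff x0 r θ x • v x with hφdef
  have h0 : ∀ x ∉ ball x0 r, φ x = 0 := by
    intro x hx
    simp [hφdef, cutoff_zero x0 hr hθ x hx]
  have hq1 := hq (ball x0 r) isOpen_ball isBounded_ball A φ ⟨_, hφ⟩ h0
  have hK := K.coe_nonneg
  have hb1 : ∀ x, |g (A + fderiv ℝ φ x)| ≤ C0 := by
    intro x
    apply hC0
    have := norm_fderiv_le_of_lipschitz ℝ hφ (x₀ := x)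
    push_cast at this
    linarith [norm_add_le A (fderiv ℝ φ x)]
  have hb2 : ∀ x, |g (fderiv ℝ w x)| ≤ C0 := by
    intro x
    apply hC0
    have := norm_fderiv_le_of_lipschitz ℝ hw (x₀ := x)
    linarith
  have hi1 : IntegrableOn (fun x => g (A + fderiv ℝ φ x)) (ball x0 r) := by
    refine intOn_of_bound measurableSet_ball isBounded_ball ?_ (fun x _ => hb1 x)
    exact (hg.measurable.comp ((measurable_fderiv ℝ φ).const_add A)).aestronglyMeasurable
  have hi2 : IntegrableOn (fun x => g (fderiv ℝ w x)) (ball x0 r) := by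
    refine intOn_of_bound measurableSet_ball isBounded_ball ?_ (fun x _ => hb2 x)
    exact (hg.measurable.comp (measurable_fderiv ℝ w)).aestronglyMeasurable
  set I := ball x0 ((1 - θ) * r) with hI
  have hIs : I ⊆ ball x0 r := ball_subset_ball (by nlinarith)
  set ψ : EE n → ℝ := (ball x0 r \ I).indicator (fun _ => 2 * C0) with hψ
  have hms : MeasurableSet (ball x0 r \ I) := measurableSet_ball.diff measurableSet_ball
  have hi3 : IntegrableOn ψ (ball x0 r) := by
    apply IntegrableOn.indicator _ hms
    exact integrableOn_const measure_ball_lt_top.ne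
  have hle : ∫ x in ball x0 r, g (A + fderiv ℝ φ x) ≤
      ∫ x in ball x0 r, (g (fderiv ℝ w x) + ψ x) := by
    apply integral_mono_ae hi1 (hi2.add hi3)
    rw [EventuallyLE, ae_restrict_iff' measurableSet_ball]
    filter_upwards [hw.ae_differentiableAt (μ := volume)] with x hd hx
    by_cases hxI : x ∈ I
    · have e1 : φ =ᶠ[𝓝 x] v := by
        filter_upwards [isOpen_ball.mem_nhds hxI] with y hy
        simp [hφdef, cutoff_one x0 hr hθ y hy]
      have e2 : HasFDerivAt v (fderiv ℝ w x - A) x := by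
        apply hd.hasFDerivAt.sub
        exact (A.hasFDerivAt.comp x ((hasFDerivAt_id x).sub_const x0)).const_add b
      have e3 : fderiv ℝ φ x = fderiv ℝ w x - A := by
        rw [e1.fderiv_eq, e2.fderiv]
      rw [e3]
      simp [hψ, hxI]
    · have : ψ x = 2 * C0 := by
        rw [hψ, Set.indicator_of_mem (show x ∈ ball x0 r \ I from ⟨hx, hxI⟩)]
      change _ ≤ g (fderiv ℝ w x) + ψ x
      rw [this]
      have a1 := abs_le.1 (hb1 x)
      have a2 := abs_le.1 (hb2 x)
      linarith
  have hψi : ∫ x in ball x0 r, ψ x = 2 * C0 * (1 - (1 - θ) ^ n) * volume.real (ball x0 r) := by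
    rw [hψ, setIntegral_indicator hms, Set.inter_eq_self_of_subset_right Set.sdiff_subset,
      setIntegral_const, smul_eq_mul, measureReal_sdiff hIs measurableSet_ball]
    have e1 : volume.real I = (1 - θ) ^ n * volume.real (ball x0 r) := by
      have h1θ : 0 < 1 - θ := by linarith
      rw [hI, Measure.real, Measure.real, Measure.addHaar_ball_of_pos _ _ hr,
        Measure.addHaar_ball_of_pos _ _ (mul_pos h1θ hr), ENNReal.toReal_mul, ENNReal.toReal_mul,
        ENNReal.toReal_ofReal (by positivity), ENNReal.toReal_ofReal (by positivity)]
      simp [mul_pow, mul_assoc]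
    rw [e1]; ring
  rw [integral_add hi2 hi3, hψi] at hle
  linarith

lemma exists_theta (C0 : ℝ) (n : ℕ) {ε : ℝ} (hε : 0 < ε) :
    ∃ θ : ℝ, 0 < θ ∧ θ < 1 ∧ 2 * C0 * (1 - (1 - θ) ^ n) ≤ ε := by
  have hc : ContinuousAt (fun θ : ℝ => 2 * C0 * (1 - (1 - θ) ^ n)) 0 := by fun_prop
  have h1 : ∀ᶠ θ in 𝓝 (0 : ℝ), 2 * C0 * (1 - (1 - θ) ^ n) < ε := by
    apply hc.eventually_lt continuousAt_const
    simpa using hε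
  have h2 : ∀ᶠ θ in 𝓝[>] (0 : ℝ), 2 * C0 * (1 - (1 - θ) ^ n) < ε := h1.filter_mono nhdsWithin_le_nhds
  have h3 : ∀ᶠ θ in 𝓝[>] (0 : ℝ), θ ∈ Set.Ioo (0 : ℝ) 1 := Ioo_mem_nhdsGT one_pos
  obtain ⟨θ, ha, hb⟩ := (h2.and h3).exists
  exact ⟨θ, hb.1, hb.2, ha.le⟩

lemma local_step {m n : ℕ} (Ω : Set (EE n)) (hΩo : IsOpen Ω)
    (G : EE n × EE m × (EE n →L[ℝ] EE m) → ℝ) (hG : Continuous G)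
    (hq : ∀ x ∈ Ω, ∀ s, QC (fun L => G (x, s, L)))
    (u : ℕ → EE n → EE m) (ulim : EE n → EE m) (K : ℝ≥0) (hLip : ∀ j, LipschitzWith K (u j))
    (hlimL : LipschitzOnWith K ulim Ω)
    (C : ℝ) (hC : ∀ j, ∀ x ∈ Ω, ‖u j x‖ ≤ C) (hClim : ∀ x ∈ Ω, ‖ulim x‖ ≤ C)
    (hconv : TendstoUniformlyOn u ulim atTop Ω) (C0 : ℝ)
    (hΩb : Bornology.IsBounded Ω)
    (hC0 : ∀ x ∈ Ω, ∀ s : EE m, ‖s‖ ≤ C → ∀ A : EE n →L[ℝ] EE m, ‖A‖ ≤ 3 * K + 1 →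
      |G (x, s, A)| ≤ C0)
    (x0 : EE n) (hx0 : x0 ∈ Ω) (hd : DifferentiableAt ℝ ulim x0)
    (hleb : Tendsto (fun r => ⨍ y in closedBall x0 r, G (y, ulim y, fderiv ℝ ulim y)) (𝓝[>] 0)
      (𝓝 (G (x0, ulim x0, fderiv ℝ ulim x0)))) {ε : ℝ} (hε : 0 < ε) :
    ∀ᶠ r in 𝓝[>] (0 : ℝ), closedBall x0 r ⊆ Ω ∧ ∀ᶠ j in atTop,
      (∫ x in closedBall x0 r, G (x, ulim x, fderiv ℝ ulim x)) ≤
      (∫ x in closedBall x0 r, G (x, u j x, fderiv ℝ (u j) x)) +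
        3 * ε * volume.real (closedBall x0 r) := by
  have hK := K.coe_nonneg
  obtain ⟨θ, hθ, hθ1, hθε⟩ := exists_theta C0 n hε
  -- uniform continuity
  have hcomp : IsCompact (closure Ω ×ˢ (closedBall (0 : EE m) C ×ˢ
      closedBall (0 : EE n →L[ℝ] EE m) (3 * K + 1))) := by
    have : ProperSpace (EE n →L[ℝ] EE m) := FiniteDimensional.proper ℝ _
    exact hΩb.isCompact_closure.prod ((isCompact_closedBall _ _).prod (isCompact_closedBall _ _))
  have huc := hcomp.uniformContinuousOn_of_continuous hG.continuousOn
  obtain ⟨δ, hδ, hδG⟩ := Metric.uniformContinuousOn_iff.1 huc ε hε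
  set A := fderiv ℝ ulim x0 with hA
  have hAK : ‖A‖ ≤ K := norm_fderiv_le_of_lipschitzOn ℝ (hΩo.mem_nhds hx0) hlimL
  -- smallness of r
  have r0 : ∀ᶠ r in 𝓝[>] (0 : ℝ), 0 < r := self_mem_nhdsWithin
  have r1 : ∀ᶠ r in 𝓝[>] (0 : ℝ), closedBall x0 r ⊆ Ω := by
    obtain ⟨ρ, hρ, hb⟩ := Metric.isOpen_iff.1 hΩo x0 hx0
    filter_upwards [Ioo_mem_nhdsGT hρ] with r hr
    exact (closedBall_subset_ball hr.2).trans hb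
  have r2 : ∀ᶠ r in 𝓝[>] (0 : ℝ), (K + 1) * r < δ / 2 := by
    have : Tendsto (fun r : ℝ => (K + 1) * r) (𝓝[>] 0) (𝓝 ((K + 1) * 0)) :=
      ((continuous_const.mul continuous_id).tendsto 0).mono_left nhdsWithin_le_nhds
    rw [mul_zero] at this
    exact this.eventually_lt_const (by positivity)
  have r3 : ∀ᶠ r in 𝓝[>] (0 : ℝ), ∀ x ∈ closedBall x0 r,
      ‖ulim x - (ulim x0 + A (x - x0))‖ ≤ θ / 2 * r := by
    have h := hd.hasFDerivAt.isLittleO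
    have h' := h.def (show 0 < θ / 2 by positivity)
    obtain ⟨ρ, hρ, hb⟩ := Metric.eventually_nhds_iff.1 h'
    filter_upwards [Ioo_mem_nhdsGT hρ] with r hr x hx
    have := hb (lt_of_le_of_lt hx hr.2)
    rw [← sub_sub]
    refine this.trans ?_
    rw [← dist_eq_norm]
    exact mul_le_mul_of_nonneg_left hx (by positivity)
  have r4 : ∀ᶠ r in 𝓝[>] (0 : ℝ), (⨍ y in closedBall x0 r, G (y, ulim y, fderiv ℝ ulim y)) <
      G (x0, ulim x0, A) + ε := hleb.eventually_lt_const (by linarith)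
  filter_upwards [r0, r1, r2, r3, r4] with r h0 h1 h2 h3 h4
  refine ⟨h1, ?_⟩
  have hvol : 0 < volume.real (closedBall x0 r) :=
    ENNReal.toReal_pos (measure_closedBall_pos _ _ h0).ne' measure_closedBall_lt_top.ne
  have h4' : ∫ x in closedBall x0 r, G (x, ulim x, fderiv ℝ ulim x) ≤
      (G (x0, ulim x0, A) + ε) * volume.real (closedBall x0 r) := by
    rw [setAverage_eq, smul_eq_mul, inv_mul_lt_iff₀ hvol] at h4
    linarith
  have hη : 0 < min (θ / 2 * r) (δ / 2) := by positivity
  filter_upwards [Metric.tendstoUniformlyOn_iff.1 hconv _ hη] with j hj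
  have hjK := fun x => norm_fderiv_le_of_lipschitz ℝ (hLip j) (x₀ := x)
  have hbc : ball x0 r ⊆ closedBall x0 r := ball_subset_closedBall
  have hae : ball x0 r =ᵐ[volume] closedBall x0 r := by
    refine LE.le.eventuallyLE hbc |>.antisymm ?_
    rw [ae_le_set, closedBall_sdiff_ball]
    exact Measure.addHaar_sphere_of_ne_zero _ _ h0.ne'
  have hvr : volume.real (ball x0 r) = volume.real (closedBall x0 r) := measureReal_congr hae
  have L := local_ineq (fun L => G (x0, ulim x0, L)) (by fun_prop) (hq x0 hx0 _) K (C0 := C0)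
    (fun A hA => hC0 x0 hx0 _ (hClim x0 hx0) A hA) x0 h0 hθ hθ1 A hAK (ulim x0) (u j) (hLip j) (by
      intro x hx
      have a1 := h3 x (hbc hx)
      have a2 := (hj x (h1 (hbc hx))).le.trans (min_le_left _ _)
      rw [dist_comm, dist_eq_norm] at a2
      calc _ = ‖(u j x - ulim x) + (ulim x - (ulim x0 + A (x - x0)))‖ := by congr 1; abel
        _ ≤ _ := norm_add_le _ _
        _ ≤ θ * r := by linarith)
  rw [setIntegral_congr_set hae, hvr] at L
  have hcb := measurableSet_closedBall (x := x0) (ε := r)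
  have i1 : IntegrableOn (fun x => G (x0, ulim x0, fderiv ℝ (u j) x)) (closedBall x0 r) := by
    refine intOn_of_bound hcb isBounded_closedBall ?_ (C := C0) ?_
    · exact (hG.measurable.comp (measurable_const.prodMk (measurable_const.prodMk
        (measurable_fderiv ℝ (u j))))).aestronglyMeasurable
    · intro x hx
      exact hC0 _ hx0 _ (hClim _ hx0) _ (by linarith [hjK x])
  have i2 : IntegrableOn (fun x => G (x, u j x, fderiv ℝ (u j) x)) (closedBall x0 r) := by
    refine intOn_of_bound hcb isBounded_closedBall ?_ (C := C0) ?_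
    · exact (hG.measurable.comp (measurable_id.prodMk ((hLip j).continuous.measurable.prodMk
        (measurable_fderiv ℝ (u j))))).aestronglyMeasurable
    · intro x hx
      exact hC0 _ (h1 hx) _ (hC j x (h1 hx)) _ (by linarith [hjK x])
  have i3 : IntegrableOn (fun _ : EE n => ε) (closedBall x0 r) :=
    integrableOn_const measure_closedBall_lt_top.ne
  have hmono : ∫ x in closedBall x0 r, G (x0, ulim x0, fderiv ℝ (u j) x) ≤
      ∫ x in closedBall x0 r, (G (x, u j x, fderiv ℝ (u j) x) + ε) := by
    apply setIntegral_mono_on i1 (i2.add i3) hcb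
    intro x hx
    have hL : fderiv ℝ (u j) x ∈ closedBall (0 : EE n →L[ℝ] EE m) (3 * K + 1) := by
      rw [mem_closedBall_zero_iff]; linarith [hjK x]
    have hxr : dist x x0 ≤ r := hx
    have := hδG (x0, ulim x0, fderiv ℝ (u j) x)
      ⟨subset_closure hx0, by simpa using hClim _ hx0, hL⟩ (x, u j x, fderiv ℝ (u j) x)
      ⟨subset_closure (h1 hx), by simpa using hC j _ (h1 hx), hL⟩ (by
        simp only [Prod.dist_eq, dist_self]
        apply max_lt
        · rw [dist_comm]; nlinarith
        · apply max_lt _ hδ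
          have a1 := hlimL.dist_le_mul _ hx0 _ (h1 hx)
          have a2 := (hj x (h1 hx)).le.trans (min_le_right _ _)
          have a3 := dist_triangle (ulim x0) (ulim x) (u j x)
          rw [dist_comm x0 x] at a1
          nlinarith)
    rw [Real.dist_eq] at this
    change _ ≤ G (x, u j x, fderiv ℝ (u j) x) + ε
    linarith [(abs_lt.1 this).2]
  rw [integral_add i2 i3, setIntegral_const, smul_eq_mul] at hmono
  have := mul_le_mul_of_nonneg_right hθε hvol.le
  nlinarith

lemma core {m n : ℕ} (Ω : Set (EE n)) (hΩo : IsOpen Ω) (hΩb : Bornology.IsBounded Ω)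
    (G : EE n × EE m × (EE n →L[ℝ] EE m) → ℝ) (hG : Continuous G)
    (hq : ∀ x ∈ Ω, ∀ s, QC (fun L => G (x, s, L)))
    (u : ℕ → EE n → EE m) (ulim : EE n → EE m) (K : ℝ≥0) (hLip : ∀ j, LipschitzWith K (u j))
    (C : ℝ) (hC : ∀ j, ∀ x ∈ Ω, ‖u j x‖ ≤ C)
    (hconv : TendstoUniformlyOn u ulim atTop Ω) :
    (∫ x in Ω, G (x, ulim x, fderiv ℝ ulim x)) ≤
      liminf (fun j => ∫ x in Ω, G (x, u j x, fderiv ℝ (u j) x)) atTop := by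
  have hK := K.coe_nonneg
  have hpt : ∀ x ∈ Ω, Tendsto (fun j => u j x) atTop (𝓝 (ulim x)) :=
    fun x hx => hconv.tendsto_at hx
  have hlimL : LipschitzOnWith K ulim Ω := by
    apply LipschitzOnWith.of_dist_le_mul
    intro x hx y hy
    exact le_of_tendsto ((hpt x hx).dist (hpt y hy))
      (Eventually.of_forall fun j => (hLip j).dist_le_mul x y)
  have hClim : ∀ x ∈ Ω, ‖ulim x‖ ≤ C := fun x hx =>
    le_of_tendsto (hpt x hx).norm (Eventually.of_forall fun j => hC j x hx)
  have hcomp : IsCompact (closure Ω ×ˢ (closedBall (0 : EE m) C ×ˢ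
      closedBall (0 : EE n →L[ℝ] EE m) (3 * K + 1))) := by
    have : ProperSpace (EE n →L[ℝ] EE m) := FiniteDimensional.proper ℝ _
    exact hΩb.isCompact_closure.prod ((isCompact_closedBall _ _).prod (isCompact_closedBall _ _))
  obtain ⟨C0, hC0'⟩ := hcomp.exists_bound_of_continuousOn hG.continuousOn
  have hC0 : ∀ x ∈ Ω, ∀ s : EE m, ‖s‖ ≤ C → ∀ A : EE n →L[ℝ] EE m, ‖A‖ ≤ 3 * K + 1 →
      |G (x, s, A)| ≤ C0 := fun x hx s hs A hA =>
    hC0' (x, s, A) ⟨subset_closure hx, by simpa using hs, by simpa using hA⟩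
  have hΩm := hΩo.measurableSet
  have hbj : ∀ j, ∀ x ∈ Ω, |G (x, u j x, fderiv ℝ (u j) x)| ≤ C0 := fun j x hx =>
    hC0 x hx _ (hC j x hx) _ (by linarith [norm_fderiv_le_of_lipschitz ℝ (hLip j) (x₀ := x)])
  have hbl : ∀ x ∈ Ω, |G (x, ulim x, fderiv ℝ ulim x)| ≤ C0 := fun x hx =>
    hC0 x hx _ (hClim x hx) _
      (by linarith [norm_fderiv_le_of_lipschitzOn ℝ (hΩo.mem_nhds hx) hlimL])
  have ij : ∀ j, IntegrableOn (fun x => G (x, u j x, fderiv ℝ (u j) x)) Ω := fun j =>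
    intOn_of_bound hΩm hΩb (hG.measurable.comp (measurable_id.prodMk
      ((hLip j).continuous.measurable.prodMk (measurable_fderiv ℝ (u j))))).aestronglyMeasurable
      (hbj j)
  have il : IntegrableOn (fun x => G (x, ulim x, fderiv ℝ ulim x)) Ω := by
    refine intOn_of_bound hΩm hΩb ?_ hbl
    have hm : AEMeasurable ulim (volume.restrict Ω) := hlimL.continuousOn.aemeasurable hΩm
    exact (hG.measurable.comp_aemeasurable (measurable_id.aemeasurable.prodMk
      (hm.prodMk (measurable_fderiv ℝ ulim).aemeasurable))).aestronglyMeasurable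
  have iconst : ∀ c : ℝ, IntegrableOn (fun _ : EE n => c) Ω := fun c =>
    integrableOn_const hΩb.measure_lt_top.ne
  have hbound : ∀ j, ∫ x in Ω, G (x, u j x, fderiv ℝ (u j) x) ≤ C0 * volume.real Ω := by
    intro j
    have := setIntegral_mono_on (ij j) (iconst C0) hΩm (fun x hx => (abs_le.1 (hbj j x hx)).2)
    rwa [setIntegral_const, smul_eq_mul, mul_comm] at this
  -- reduce to an eventual inequality
  suffices H : ∀ ε > 0, ∀ᶠ j in atTop, (∫ x in Ω, G (x, ulim x, fderiv ℝ ulim x))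
      - (3 * ε * volume.real Ω + ε) ≤ ∫ x in Ω, G (x, u j x, fderiv ℝ (u j) x) by
    have hcob : IsCoboundedUnder (· ≥ ·) atTop
        (fun j => ∫ x in Ω, G (x, u j x, fderiv ℝ (u j) x)) :=
      (isBoundedUnder_of ⟨_, hbound⟩ : IsBoundedUnder (· ≤ ·) atTop _).isCoboundedUnder_ge
    have h1 : ∀ ε > 0, (∫ x in Ω, G (x, ulim x, fderiv ℝ ulim x))
      - (3 * ε * volume.real Ω + ε) ≤
        liminf (fun j => ∫ x in Ω, G (x, u j x, fderiv ℝ (u j) x)) atTop :=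
      fun ε hε => le_liminf_of_le hcob (H ε hε)
    have ht : Tendsto (fun ε : ℝ => (∫ x in Ω, G (x, ulim x, fderiv ℝ ulim x))
      - (3 * ε * volume.real Ω + ε)) (𝓝[>] 0)
      (𝓝 ((∫ x in Ω, G (x, ulim x, fderiv ℝ ulim x)) - (3 * 0 * volume.real Ω + 0))) := by
      apply Tendsto.mono_left _ nhdsWithin_le_nhds
      apply Continuous.tendsto (f := fun ε : ℝ => (∫ x in Ω, G (x, ulim x, fderiv ℝ ulim x))
        - (3 * ε * volume.real Ω + ε))
      fun_prop
    simp only [mul_zero, zero_mul, add_zero, sub_zero] at ht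
    exact le_of_tendsto ht (by filter_upwards [self_mem_nhdsWithin] with ε hε using h1 ε hε)
  intro ε hε
  -- almost every point is good
  have hleb := IsUnifLocDoublingMeasure.ae_tendsto_average (μ := (volume : Measure (EE n)))
    ((integrable_indicator_iff hΩm).2 il).locallyIntegrable 1
  have hdiff := hlimL.ae_differentiableWithinAt_of_mem (μ := (volume : Measure (EE n)))
  set P : EE n → ℝ → Prop := fun x0 r => closedBall x0 r ⊆ Ω ∧ ∀ᶠ j in atTop,
      (∫ x in closedBall x0 r, G (x, ulim x, fderiv ℝ ulim x)) ≤
      (∫ x in closedBall x0 r, G (x, u j x, fderiv ℝ (u j) x)) +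
        3 * ε * volume.real (closedBall x0 r) with hP
  set S : Set (EE n) := {x | x ∈ Ω ∧ ∀ᶠ r in 𝓝[>] (0 : ℝ), P x r} with hS
  have hSae : ∀ᵐ x ∂(volume : Measure (EE n)), x ∈ Ω → x ∈ S := by
    filter_upwards [hleb, hdiff] with x hx1 hx2 hx
    refine ⟨hx, ?_⟩
    have hd := (hx2 hx).differentiableAt (hΩo.mem_nhds hx)
    refine local_step Ω hΩo G hG hq u ulim K hLip hlimL C hC hClim hconv C0 hΩb hC0 x hx hd ?_ hε
    have := hx1 (l := 𝓝[>] (0 : ℝ)) (fun _ => x) (fun r => r) tendsto_id (by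
      filter_upwards [self_mem_nhdsWithin] with r hr
      have hr' : (0 : ℝ) < r := hr
      simp [hr'.le])
    rw [Set.indicator_of_mem hx] at this
    refine this.congr' ?_
    obtain ⟨ρ, hρ, hb⟩ := Metric.isOpen_iff.1 hΩo x hx
    filter_upwards [Ioo_mem_nhdsGT hρ] with r hr
    apply setAverage_congr_fun measurableSet_closedBall
    refine Eventually.of_forall fun y hy => ?_
    rw [Set.indicator_of_mem (hb (closedBall_subset_ball hr.2 hy))]
  obtain ⟨t, r, htc, htS, htr, htm, htd⟩ :=
    Besicovitch.exists_disjoint_closedBall_covering_ae (volume : Measure (EE n))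
      (fun x => {r | P x r}) S (by
        intro x hx δ hδ
        obtain ⟨r, h1, h2⟩ := (hx.2.and (Ioo_mem_nhdsGT hδ)).exists
        exact ⟨r, h1, h2⟩) (fun _ => 1) (fun _ _ => one_pos)
  have hPt : ∀ x : t, P x (r x) := fun x => (htr x x.2).1
  have : Countable t := htc.to_subtype
  set B : t → Set (EE n) := fun x => closedBall x (r x) with hB
  have hBm : ∀ i, MeasurableSet (B i) := fun i => measurableSet_closedBall
  have hBΩ : ∀ i, B i ⊆ Ω := fun i => (hPt i).1
  have hBU : (⋃ i, B i) ⊆ Ω := Set.iUnion_subset hBΩ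
  have hBd : Pairwise (Function.onFun Disjoint B) := by
    intro i j hij
    exact htd i.2 j.2 (fun h => hij (Subtype.ext h))
  have hcov : (⋃ i, B i) =ᵐ[volume] Ω := by
    refine LE.le.eventuallyLE hBU |>.antisymm ?_
    have h1 : ∀ᵐ x ∂(volume : Measure (EE n)), x ∉ S \ ⋃ x ∈ t, closedBall x (r x) :=
      measure_eq_zero_iff_ae_notMem.1 htm
    filter_upwards [h1, hSae] with x hx1 hx2 hx
    by_contra hcon
    apply hx1
    refine ⟨hx2 hx, fun h => hcon ?_⟩
    simp only [Set.mem_iUnion] at h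
    obtain ⟨i, hi, hxi⟩ := h
    exact Set.mem_iUnion.2 ⟨⟨i, hi⟩, hxi⟩
  -- the sum
  set φ : EE n → ℝ := fun x => G (x, ulim x, fderiv ℝ ulim x) + (C0 - 3 * ε) with hφ
  have iφ : IntegrableOn φ Ω := il.add (iconst _)
  have hsum := hasSum_integral_iUnion hBm hBd (iφ.mono_set hBU)
  rw [setIntegral_congr_set hcov] at hsum
  obtain ⟨F, hF⟩ := (hsum.eventually_const_lt
    (show (∫ x in Ω, φ x) - ε < ∫ x in Ω, φ x by linarith)).exists
  have hall : ∀ᶠ j in atTop, ∀ i ∈ F, (∫ x in B i, G (x, ulim x, fderiv ℝ ulim x)) ≤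
      (∫ x in B i, G (x, u j x, fderiv ℝ (u j) x)) + 3 * ε * volume.real (B i) :=
    (Filter.eventually_all_finset F).2 fun i _ => (hPt i).2
  filter_upwards [hall] with j hj
  have iψ : IntegrableOn (fun x => G (x, u j x, fderiv ℝ (u j) x) + C0) Ω := (ij j).add (iconst _)
  have s1 : ∑ i ∈ F, ∫ x in B i, φ x ≤
      ∑ i ∈ F, ∫ x in B i, (G (x, u j x, fderiv ℝ (u j) x) + C0) := by
    apply Finset.sum_le_sum
    intro i hi
    rw [hφ, integral_add (il.mono_set (hBΩ i)) ((iconst _).mono_set (hBΩ i)),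
      integral_add ((ij j).mono_set (hBΩ i)) ((iconst _).mono_set (hBΩ i)),
      setIntegral_const, setIntegral_const, smul_eq_mul, smul_eq_mul]
    linarith [hj i hi]
  have s2 : ∑ i ∈ F, ∫ x in B i, (G (x, u j x, fderiv ℝ (u j) x) + C0) ≤
      ∫ x in Ω, (G (x, u j x, fderiv ℝ (u j) x) + C0) := by
    rw [← integral_biUnion_finset F (fun i _ => hBm i) (fun i _ k _ hik => hBd hik)
      (fun i _ => iψ.mono_set (hBΩ i))]
    apply setIntegral_mono_set iψ
    · rw [EventuallyLE, ae_restrict_iff' hΩm]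
      refine Eventually.of_forall fun x hx => ?_
      have := (abs_le.1 (hbj j x hx)).1
      simp only [Pi.zero_apply]; linarith
    · exact LE.le.eventuallyLE (Set.iUnion₂_subset fun i _ => hBΩ i)
  rw [integral_add (ij j) (iconst _), setIntegral_const, smul_eq_mul] at s2
  rw [hφ, integral_add il (iconst _), setIntegral_const, smul_eq_mul] at hF
  simp only [hφ] at s1
  linarith

/-- The matrix of a continuous linear map. -/
def toMat {m n : ℕ} (L : EE n →L[ℝ] EE m) : Matrix (Fin m) (Fin n) ℝ :=
  Matrix.of fun i j => L (EuclideanSpace.single j 1) i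

lemma toMat_continuous {m n : ℕ} : Continuous (toMat : (EE n →L[ℝ] EE m) → _) := by
  refine continuous_pi fun i => continuous_pi fun j => ?_
  change Continuous fun L : EE n →L[ℝ] EE m => L (EuclideanSpace.single j 1) i
  fun_prop

lemma toMat_add {m n : ℕ} (L M : EE n →L[ℝ] EE m) : toMat (L + M) = toMat L + toMat M := by
  ext i j
  simp [toMat]

lemma QC_of {m n : ℕ} {g : Matrix (Fin m) (Fin n) ℝ → ℝ} (hg : QuasiconvexFn g) :
    QC (fun L : EE n →L[ℝ] EE m => g (toMat L)) := by
  intro D hD hDb A φ hφ h0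
  have := hg D hD hDb (toMat A) φ hφ h0
  simp only [toMat_add]
  exact this

/-- Morrey's sufficiency theorem (Meyers' theorem for `k = 1`, sufficiency part): if
`f : Ω̄ × ℝᵐ × ℝ^{m×n} → ℝ` is continuous and quasiconvex in the last variable, then the
functional `u ↦ ∫_Ω f(x, u, ∇u)` is sequentially weakly* lower semicontinuous on
`W^{1,∞}(Ω;ℝᵐ)`: for any sequence of uniformly Lipschitz, uniformly bounded maps `u_j`
converging uniformly on `Ω` to `u`,
`∫_Ω f(x,u,∇u) ≤ liminf_j ∫_Ω f(x,u_j,∇u_j)`. -/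
theorem stmt17 {m n : ℕ} (Ω : Set (EuclideanSpace ℝ (Fin n)))
    (hΩo : IsOpen Ω) (hΩb : Bornology.IsBounded Ω) (hΩl : HasLipschitzBoundary Ω)
    (f : EuclideanSpace ℝ (Fin n) → EuclideanSpace ℝ (Fin m) → Matrix (Fin m) (Fin n) ℝ → ℝ)
    (hfc : ContinuousOn
      (fun q : EuclideanSpace ℝ (Fin n) ×
          (EuclideanSpace ℝ (Fin m) × Matrix (Fin m) (Fin n) ℝ) => f q.1 q.2.1 q.2.2)
      (closure Ω ×ˢ (Set.univ : Set (EuclideanSpace ℝ (Fin m) × Matrix (Fin m) (Fin n) ℝ))))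
    (hqc : ∀ x ∈ closure Ω, ∀ s : EuclideanSpace ℝ (Fin m), QuasiconvexFn (f x s))
    (u : ℕ → EuclideanSpace ℝ (Fin n) → EuclideanSpace ℝ (Fin m))
    (ulim : EuclideanSpace ℝ (Fin n) → EuclideanSpace ℝ (Fin m))
    (K : ℝ≥0) (hLip : ∀ j, LipschitzWith K (u j))
    (hbd : ∃ C : ℝ, ∀ j, ∀ x ∈ Ω, ‖u j x‖ ≤ C)
    (hconv : TendstoUniformlyOn u ulim atTop Ω) :
    (∫ x in Ω, f x (ulim x) (grad ulim x)) ≤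
      Filter.liminf (fun j => ∫ x in Ω, f x (u j x) (grad (u j) x)) Filter.atTop := by
  obtain ⟨C, hC⟩ := hbd
  set S : Set (EE n × EE m × (EE n →L[ℝ] EE m)) := closure Ω ×ˢ Set.univ with hS
  have hSc : IsClosed S := isClosed_closure.prod isClosed_univ
  have hcont : ContinuousOn
      (fun q : EE n × EE m × (EE n →L[ℝ] EE m) => f q.1 q.2.1 (toMat q.2.2)) S := by
    refine hfc.comp (f := fun q : EE n × EE m × (EE n →L[ℝ] EE m) =>
      (q.1, (q.2.1, toMat q.2.2))) ?_ ?_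
    · exact (continuous_fst.prodMk ((continuous_fst.comp continuous_snd).prodMk
        (toMat_continuous.comp (continuous_snd.comp continuous_snd)))).continuousOn
    · intro q hq
      exact ⟨hq.1, Set.mem_univ _⟩
  obtain ⟨G, hG⟩ := ContinuousMap.exists_restrict_eq hSc
    (⟨_, hcont.domRestrict⟩ : C(S, ℝ))
  have hGf : ∀ x ∈ closure Ω, ∀ s L, G (x, s, L) = f x s (toMat L) := by
    intro x hx s L
    exact congrArg (fun h : C(S, ℝ) => h ⟨(x, s, L), ⟨hx, Set.mem_univ _⟩⟩) hG
  have e : ∀ w : EE n → EE m, ∫ x in Ω, f x (w x) (grad w x) =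
      ∫ x in Ω, G (x, w x, fderiv ℝ w x) := by
    intro w
    apply setIntegral_congr_fun hΩo.measurableSet
    intro x hx
    exact (hGf x (subset_closure hx) _ _).symm
  simp only [e]
  refine core Ω hΩo hΩb G G.continuous ?_ u ulim K hLip C hC hconv
  intro x hx s
  have : (fun L => G (x, s, L)) = fun L => f x s (toMat L) :=
    funext fun L => hGf x (subset_closure hx) s L
  rw [this]
  exact QC_of (hqc x (subset_closure hx) s)
end
end
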